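/- Let G be a 2-connected distance-hereditary graph. Then G is matching-decyclable if and only if G is isomorphic to one of: the triangle, the square C₄, the diamond, K_{2,3}, or K_{3,3} minus an edge. Equivalently, G is matching-decyclable if and only if G is sparse and K_{2,4}-free. -/

import Mathlib

open SimpleGraph

/-- `M` is a matching contained in the edge set of `G`. -/
def IsMatchingIn {V : Type*} (G : SimpleGraph V) (M : Set (Sym2 V)) : Prop :=
  M ⊆ G.edgeSet ∧ ∀ e ∈ M, ∀ f ∈ M, e ≠ f → ∀ v : V, v ∈ e → v ∉ f

/-- `G` is matching-decyclable: some matching `M ⊆ E(G)` has `G - M` acyclic. -/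
def MDecyclable {V : Type*} (G : SimpleGraph V) : Prop :=
  ∃ M : Set (Sym2 V), IsMatchingIn G M ∧ (G.deleteEdges M).IsAcyclic

/-- `G` is sparse: every nonempty subgraph `H` satisfies `|E(H)| ≤ ⌊3|V(H)|/2⌋ - 1`. -/
def Sparse {V : Type*} (G : SimpleGraph V) : Prop :=
  ∀ H : G.Subgraph, H.verts.Nonempty →
    Nat.card H.edgeSet ≤ 3 * Nat.card H.verts / 2 - 1

/-- A graph is 2-connected: connected, at least 3 vertices, and no cut vertex. -/
def TwoConnected {V : Type*} (G : SimpleGraph V) : Prop :=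
  G.Connected ∧ 3 ≤ Nat.card V ∧
    ∀ v : V, (((⊤ : G.Subgraph).deleteVerts {v}).coe).Connected

/-- `G` is fairly cubic: exactly two vertices of degree 2, the rest of degree 3. -/
def FairlyCubic {V : Type*} [Fintype V] (G : SimpleGraph V) [DecidableRel G.Adj] : Prop :=
  Nat.card {v : V // G.degree v = 2} = 2 ∧ ∀ v : V, G.degree v = 2 ∨ G.degree v = 3

def diamondGraph : SimpleGraph (Fin 4) :=
  SimpleGraph.fromEdgeSet {s(0,1), s(0,2), s(0,3), s(1,2), s(2,3)}

def triangleGraph : SimpleGraph (Fin 3) := ⊤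

def gemGraph : SimpleGraph (Fin 5) :=
  SimpleGraph.fromEdgeSet {s(0,1), s(1,2), s(2,3), s(0,4), s(1,4), s(2,4), s(3,4)}

def houseGraph : SimpleGraph (Fin 5) :=
  SimpleGraph.fromEdgeSet {s(0,1), s(1,2), s(2,3), s(0,3), s(0,4), s(1,4)}

def dominoGraph : SimpleGraph (Fin 6) :=
  SimpleGraph.fromEdgeSet {s(0,1), s(1,2), s(2,3), s(0,3), s(1,4), s(4,5), s(2,5)}

/-- `K_{3,3}` minus one edge. -/
def K33minus : SimpleGraph (Fin 3 ⊕ Fin 3) :=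
  SimpleGraph.fromEdgeSet
    {e ∈ (completeBipartiteGraph (Fin 3) (Fin 3)).edgeSet | e ≠ s(Sum.inl 0, Sum.inr 0)}

/-- `G` contains `H` as a (not necessarily induced) subgraph. -/
def ContainsSub {V W : Type*} (G : SimpleGraph V) (H : SimpleGraph W) : Prop :=
  ∃ B : G.Subgraph, Nonempty (B.coe ≃g H)

/-- Chordal: no induced cycle of length at least 4. -/
def Chordal {V : Type*} (G : SimpleGraph V) : Prop :=
  ∀ n : ℕ, 4 ≤ n → IsEmpty (SimpleGraph.cycleGraph n ↪g G)

/-- Distance-hereditary: no induced house, hole, domino, or gem. -/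
def DistHereditary {V : Type*} (G : SimpleGraph V) : Prop :=
  IsEmpty (houseGraph ↪g G) ∧ IsEmpty (dominoGraph ↪g G) ∧ IsEmpty (gemGraph ↪g G) ∧
    ∀ n : ℕ, 5 ≤ n → IsEmpty (SimpleGraph.cycleGraph n ↪g G)

/-- `v` is a cut vertex of `G`. -/
def IsCutVertex {V : Type*} (G : SimpleGraph V) (v : V) : Prop :=
  G.Connected ∧ ¬ (((⊤ : G.Subgraph).deleteVerts {v}).coe).Connected

/-- A block of `G`: either (the subgraph spanned by) a bridge, or a maximal
2-connected subgraph. -/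
def IsBlock {V : Type*} (G : SimpleGraph V) (B : G.Subgraph) : Prop :=
  (∃ u w : V, G.IsBridge s(u, w) ∧ B.verts = {u, w} ∧ B.edgeSet = {s(u, w)}) ∨
  (TwoConnected B.coe ∧ ∀ B' : G.Subgraph, B ≤ B' → TwoConnected B'.coe → B' = B)

/-- A leaf block: a block containing exactly one cut vertex of `G`. -/
def IsLeafBlock {V : Type*} (G : SimpleGraph V) (B : G.Subgraph) : Prop :=
  IsBlock G B ∧ ∃! v : V, v ∈ B.verts ∧ IsCutVertex G v

/-- A chain: a connected graph with exactly two leaf blocks, whose leaf blocks are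
diamonds and whose non-leaf blocks are triangles. -/
def IsChainGraph {V : Type*} (G : SimpleGraph V) : Prop :=
  G.Connected ∧
  Nat.card {B : G.Subgraph // IsLeafBlock G B} = 2 ∧
  (∀ B : G.Subgraph, IsLeafBlock G B → Nonempty (B.coe ≃g diamondGraph)) ∧
  (∀ B : G.Subgraph, IsBlock G B → ¬ IsLeafBlock G B → Nonempty (B.coe ≃g triangleGraph))

lemma SimpleGraph.injective_of_adj_iff_of_twinFree {V W : Type*} {G : SimpleGraph V}
    {H : SimpleGraph W} (hH : ∀ i j, (∀ k, H.Adj i k ↔ H.Adj j k) → i = j) {f : W → V}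
    (hf : ∀ i j, G.Adj (f i) (f j) ↔ H.Adj i j) : Function.Injective f := by
  intro i j hij
  refine hH i j fun k => ?_
  rw [← hf, ← hf, hij]

/-- A map preserving and reflecting adjacency, out of a graph without twins, is an embedding. -/
def SimpleGraph.embeddingOfTwinFree {V W : Type*} {G : SimpleGraph V}
    {H : SimpleGraph W} (hH : ∀ i j, (∀ k, H.Adj i k ↔ H.Adj j k) → i = j) (f : W → V)
    (hf : ∀ i j, G.Adj (f i) (f j) ↔ H.Adj i j) : H ↪g G :=
  ⟨⟨f, injective_of_adj_iff_of_twinFree hH hf⟩, hf _ _⟩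

lemma DistHereditary.not_house {V : Type*} {G : SimpleGraph V} (h : DistHereditary G)
    {a b c d e : V} (hab : G.Adj a b) (hbc : G.Adj b c) (hcd : G.Adj c d) (had : G.Adj a d)
    (hae : G.Adj a e) (hbe : G.Adj b e) (hac : ¬ G.Adj a c) (hbd : ¬ G.Adj b d)
    (hce : ¬ G.Adj c e) (hde : ¬ G.Adj d e) : False := by
  refine h.1.false (embeddingOfTwinFree ?_ ![a, b, c, d, e] ?_)
  · simp only [houseGraph, fromEdgeSet_adj]
    decide
  · simp only [Fin.forall_fin_succ]
    simp [houseGraph, hab, hbc, hcd, had, hae, hbe, hac, hbd, hce, hde, G.adj_comm b a,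
      G.adj_comm c b, G.adj_comm d c, G.adj_comm d a, G.adj_comm e a, G.adj_comm e b,
      G.adj_comm c a, G.adj_comm d b, G.adj_comm e c, G.adj_comm e d]

lemma DistHereditary.not_gem {V : Type*} {G : SimpleGraph V} (h : DistHereditary G)
    {a b c d e : V} (hab : G.Adj a b) (hbc : G.Adj b c) (hcd : G.Adj c d) (hae : G.Adj a e)
    (hbe : G.Adj b e) (hce : G.Adj c e) (hde : G.Adj d e) (hac : ¬ G.Adj a c)
    (hbd : ¬ G.Adj b d) (had : ¬ G.Adj a d) : False := by
  refine h.2.2.1.false (embeddingOfTwinFree ?_ ![a, b, c, d, e] ?_)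
  · simp only [gemGraph, fromEdgeSet_adj]
    decide
  · simp only [Fin.forall_fin_succ]
    simp [gemGraph, hab, hbc, hcd, had, hae, hbe, hac, hbd, hce, hde, G.adj_comm b a,
      G.adj_comm c b, G.adj_comm d c, G.adj_comm d a, G.adj_comm e a, G.adj_comm e b,
      G.adj_comm c a, G.adj_comm d b, G.adj_comm e c, G.adj_comm e d]

lemma DistHereditary.not_domino {V : Type*} {G : SimpleGraph V} (h : DistHereditary G)
    {a b c d e f : V} (hab : G.Adj a b) (hbc : G.Adj b c) (hcd : G.Adj c d) (had : G.Adj a d)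
    (hbe : G.Adj b e) (hef : G.Adj e f) (hcf : G.Adj c f) (hac : ¬ G.Adj a c)
    (hbd : ¬ G.Adj b d) (hae : ¬ G.Adj a e) (haf : ¬ G.Adj a f) (hbf : ¬ G.Adj b f)
    (hce : ¬ G.Adj c e) (hde : ¬ G.Adj d e) (hdf : ¬ G.Adj d f) : False := by
  refine h.2.1.false (embeddingOfTwinFree ?_ ![a, b, c, d, e, f] ?_)
  · simp only [dominoGraph, fromEdgeSet_adj]
    decide
  · simp only [Fin.forall_fin_succ]
    simp [dominoGraph, hab, hbc, hcd, had, hae, hbe, hac, hbd, hce, hde, haf, hbf, hcf, hdf, hef,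
      G.adj_comm b a, G.adj_comm c b, G.adj_comm d c, G.adj_comm d a, G.adj_comm e a,
      G.adj_comm e b, G.adj_comm c a, G.adj_comm d b, G.adj_comm e c, G.adj_comm e d,
      G.adj_comm f a, G.adj_comm f b, G.adj_comm f c, G.adj_comm f d, G.adj_comm f e]

/-- An induced path `p 0, …, p k` and a vertex adjacent to precisely its two ends form a hole. -/
lemma DistHereditary.not_hole {V : Type*} {G : SimpleGraph V} (h : DistHereditary G)
    {k : ℕ} (hk : 3 ≤ k) (p : ℕ → V) (v : V)
    (hinj : ∀ i j, i < j → j ≤ k → p i ≠ p j)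
    (hp : ∀ i j, i < j → j ≤ k → (G.Adj (p i) (p j) ↔ j = i + 1))
    (hv : ∀ i, i ≤ k → (G.Adj (p i) v ↔ i = 0 ∨ i = k)) (hne : ∀ i, i ≤ k → p i ≠ v) : False := by
  have key : ∀ i j : Fin (k + 2), i < j →
      ((cycleGraph (k + 2)).Adj i j ↔ j.val = i.val + 1 ∨ i.val = 0 ∧ j.val = k + 1) := by
    intro i j hij
    rw [cycleGraph_adj', Fin.coe_sub_iff_le.mpr hij.le, Fin.coe_sub_iff_lt.mpr hij]
    have : i.val < j.val := hij
    omega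
  let f : Fin (k + 2) → V := fun i => if i.val ≤ k then p i else v
  have hlt : ∀ i j : Fin (k + 2), i < j →
      f i ≠ f j ∧ (G.Adj (f i) (f j) ↔ (cycleGraph (k + 2)).Adj i j) := by
    intro i j hij
    have hij' : i.val < j.val := hij
    have hi : i.val ≤ k := by omega
    rw [key i j hij]
    by_cases hj : j.val ≤ k
    · simp only [f, hi, hj, if_true]
      refine ⟨hinj _ _ hij' hj, ?_⟩
      rw [hp _ _ hij' hj]
      omega
    · simp only [f, hi, hj, if_true, if_false]
      refine ⟨hne _ hi, ?_⟩
      rw [hv _ hi]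
      omega
  refine (h.2.2.2 (k + 2) (by omega)).false ⟨⟨f, ?_⟩, ?_⟩
  · intro i j hij
    by_contra hne
    rcases lt_or_gt_of_ne hne with hl | hl
    · exact (hlt _ _ hl).1 hij
    · exact (hlt _ _ hl).1 hij.symm
  · intro i j
    rcases lt_trichotomy i j with hl | rfl | hl
    · exact (hlt _ _ hl).2
    · simp
    · rw [G.adj_comm, (cycleGraph (k + 2)).adj_comm]
      exact (hlt _ _ hl).2

/-- In a distance-hereditary graph, two neighbours of `v` joined by a walk avoiding `v` are at
distance at most two in the graph without `v`. -/
lemma DistHereditary.dist_deleteVerts_le_two {V : Type*} {G : SimpleGraph V}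
    (h : DistHereditary G) {v : V} (hc : (((⊤ : G.Subgraph).deleteVerts {v}).coe).Connected)
    (u w : ((⊤ : G.Subgraph).deleteVerts {v}).verts) (hu : G.Adj u v) (hw : G.Adj w v) :
    (((⊤ : G.Subgraph).deleteVerts {v}).coe).dist u w ≤ 2 := by
  set H := ((⊤ : G.Subgraph).deleteVerts {v}).coe with hH
  have hadj : ∀ x y, H.Adj x y ↔ G.Adj x y := by
    intro x y
    have hx := x.2
    have hy := y.2
    simp at hx hy
    simp [hH, hx, hy]
  induction hk : H.dist u w using Nat.strong_induction_on generalizing u w with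
  | _ k ih =>
    by_contra! hlt
    obtain ⟨q, hq⟩ := hc.exists_walk_length_eq_dist u w
    rw [hk] at hq
    have hq0 : q.getVert 0 = u := q.getVert_zero
    have hqk : q.getVert k = w := by rw [← hq]; exact q.getVert_length
    have hstep : ∀ i, i < k → H.Adj (q.getVert i) (q.getVert (i + 1)) := fun i hi =>
      q.adj_getVert_succ (by omega)
    have hle : ∀ i d, i + d ≤ k → H.dist (q.getVert i) (q.getVert (i + d)) ≤ d := by
      intro i d
      induction d with
      | zero => intro _; simp
      | succ d ihd =>
        intro hd
        have h1 := ihd (by omega)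
        have h2 := dist_eq_one_iff_adj.mpr (hstep (i + d) (by omega))
        have h3 := hc.dist_triangle (u := q.getVert i) (v := q.getVert (i + d))
          (w := q.getVert (i + d + 1))
        rw [← add_assoc]
        omega
    have hdist : ∀ i j, i ≤ j → j ≤ k → H.dist (q.getVert i) (q.getVert j) = j - i := by
      intro i j hij hj
      have h1 := hle 0 i (by omega)
      have h2 := hle i (j - i) (by omega)
      have h3 := hle j (k - j) (by omega)
      have e2 : i + (j - i) = j := by omega
      have e3 : j + (k - j) = k := by omega
      rw [zero_add, hq0] at h1
      rw [e2] at h2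
      rw [e3, hqk] at h3
      have t1 := hc.dist_triangle (u := u) (v := q.getVert i) (w := w)
      have t2 := hc.dist_triangle (u := q.getVert i) (v := q.getVert j) (w := w)
      omega
    have hpadj : ∀ i j, i < j → j ≤ k →
        (G.Adj (q.getVert i).1 (q.getVert j).1 ↔ j = i + 1) := by
      intro i j hij hj
      rw [← hadj, ← dist_eq_one_iff_adj, hdist i j hij.le hj]
      omega
    have hmid : ∀ i, 0 < i → i < k → G.Adj (q.getVert i).1 v → i ≤ 2 ∧ k - i ≤ 2 := by
      intro i h0 hi hiv
      have d1 := hdist 0 i (by omega) (by omega)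
      have d2 := hdist i k (by omega) (by omega)
      rw [hq0] at d1
      rw [hqk] at d2
      exact ⟨ih i hi u _ hu hiv (by omega), ih (k - i) (by omega) _ w hiv hw d2⟩
    have hne : ∀ i, (q.getVert i).1 ≠ v := by
      intro i
      have := (q.getVert i).2
      simp at this
      exact this
    have hv0 : G.Adj (q.getVert 0).1 v := by rw [hq0]; exact hu
    have hvk : G.Adj (q.getVert k).1 v := by rw [hqk]; exact hw
    by_cases hex : ∃ i, 0 < i ∧ i < k ∧ G.Adj (q.getVert i).1 v
    · obtain ⟨i, h0, hi, hiv⟩ := hex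
      obtain ⟨h1, h2⟩ := hmid i h0 hi hiv
      have hk34 : k = 3 ∨ k = 4 := by omega
      rcases hk34 with rfl | rfl
      · have p01 := (hpadj 0 1 (by omega) (by omega)).2 rfl
        have p12 := (hpadj 1 2 (by omega) (by omega)).2 rfl
        have p23 := (hpadj 2 3 (by omega) (by omega)).2 rfl
        have p02 := mt (hpadj 0 2 (by omega) (by omega)).1 (by omega)
        have p03 := mt (hpadj 0 3 (by omega) (by omega)).1 (by omega)
        have p13 := mt (hpadj 1 3 (by omega) (by omega)).1 (by omega)
        by_cases a1 : G.Adj (q.getVert 1).1 v <;> by_cases a2 : G.Adj (q.getVert 2).1 v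
        · exact h.not_gem p01 p12 p23 hv0 a1 a2 hvk p02 p13 p03
        · exact h.not_house a1 hvk.symm p23.symm p12 p01.symm hv0.symm p13
            (fun h => a2 h.symm) (fun h => p03 h.symm) (fun h => p02 h.symm)
        · exact h.not_house a2 hv0.symm p01 p12.symm p23 hvk.symm (fun h => p02 h.symm)
            (fun h => a1 h.symm) p03 p13
        · have : i = 1 ∨ i = 2 := by omega
          rcases this with rfl | rfl <;> contradiction
      · have hi2 : i = 2 := by omega
        subst hi2
        have a1 : ¬ G.Adj (q.getVert 1).1 v := fun hh => by
          have := hmid 1 (by omega) (by omega) hh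
          omega
        have a3 : ¬ G.Adj (q.getVert 3).1 v := fun hh => by
          have := hmid 3 (by omega) (by omega) hh
          omega
        have n : ∀ i j, i < j → j ≤ 4 → j ≠ i + 1 →
            ¬ G.Adj (q.getVert i).1 (q.getVert j).1 := fun i j a b c => mt (hpadj i j a b).1 c
        have s : ∀ i, i < 4 → G.Adj (q.getVert i).1 (q.getVert (i + 1)).1 := fun i a =>
          (hpadj i (i + 1) (by omega) (by omega)).2 rfl
        exact h.not_domino hv0 hiv.symm (s 1 (by omega)).symm (s 0 (by omega)) hvk.symm
          (s 3 (by omega)).symm (s 2 (by omega)) (n 0 2 (by omega) (by omega) (by omega))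
          (fun hh => a1 hh.symm) (n 0 4 (by omega) (by omega) (by omega))
          (n 0 3 (by omega) (by omega) (by omega)) (fun hh => a3 hh.symm)
          (n 2 4 (by omega) (by omega) (by omega)) (n 1 4 (by omega) (by omega) (by omega))
          (n 1 3 (by omega) (by omega) (by omega))
    · push Not at hex
      refine h.not_hole (k := k) (by omega) (fun i => (q.getVert i).1) v ?_ hpadj ?_
        (fun i _ => hne i)
      · intro i j hij hj heq
        have := hdist i j hij.le hj
        rw [Subtype.ext heq] at this
        simp at this
        omega
      · intro i hi
        constructor
        · intro hh
          by_contra hcon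
          push Not at hcon
          exact hex i (by omega) (by omega) hh
        · rintro (rfl | rfl)
          · exact hv0
          · exact hvk

/-- In a 2-connected distance-hereditary graph, two nonadjacent neighbours of `v` have another
common neighbour. -/
lemma DistHereditary.exists_common_neighbor {V : Type*} {G : SimpleGraph V}
    (h : DistHereditary G) (h2 : TwoConnected G) {v u w : V} (hu : G.Adj v u) (hw : G.Adj v w)
    (huw : u ≠ w) (hn : ¬ G.Adj u w) : ∃ x, x ≠ v ∧ G.Adj u x ∧ G.Adj w x := by
  have hc := h2.2.2 v
  let u' : ((⊤ : G.Subgraph).deleteVerts {v}).verts := ⟨u, by simpa using hu.ne'⟩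
  let w' : ((⊤ : G.Subgraph).deleteVerts {v}).verts := ⟨w, by simpa using hw.ne'⟩
  have hd := h.dist_deleteVerts_le_two hc u' w' hu.symm hw.symm
  obtain ⟨q, hq⟩ := hc.exists_walk_length_eq_dist u' w'
  rw [← hq] at hd
  have hq0 := q.getVert_zero
  have hql := q.getVert_length
  have hs : ∀ i, i < q.length → G.Adj (q.getVert i).1 (q.getVert (i + 1)).1 := by
    intro i hi
    have := q.adj_getVert_succ hi
    simp only [Subgraph.coe_adj, Subgraph.deleteVerts_adj, Subgraph.top_adj] at this
    exact this.2.2.2.2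
  have hx := (q.getVert 1).2
  simp only [Subgraph.deleteVerts_verts, Subgraph.verts_top, Set.mem_sdiff, Set.mem_univ,
    Set.mem_singleton_iff, true_and] at hx
  obtain h0 | h1 | h2 : q.length = 0 ∨ q.length = 1 ∨ q.length = 2 := by omega
  · rw [h0, hq0] at hql
    exact absurd (congrArg Subtype.val hql) huw
  · have := hs 0 (by omega)
    rw [h1] at hql
    rw [hq0, zero_add, hql] at this
    exact absurd this hn
  · have s0 := hs 0 (by omega)
    have s1 := hs 1 (by omega)
    rw [h2] at hql
    rw [hq0] at s0
    rw [one_add_one_eq_two, hql] at s1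
    exact ⟨_, hx, s0, s1.symm⟩

/-- A sparse graph has no injectively embedded copy of a graph on `Fin n` with too many edges,
listed as increasing pairs in `l`. -/
lemma Sparse.length_le {V : Type*} {G : SimpleGraph V} (hs : Sparse G) {n : ℕ} (hn : 0 < n)
    (f : Fin n → V) (hf : Function.Injective f) (l : List (Fin n × Fin n)) (hl : l.Nodup)
    (hlt : ∀ p ∈ l, p.1 < p.2) (hadj : ∀ p ∈ l, G.Adj (f p.1) (f p.2)) :
    l.length ≤ 3 * n / 2 - 1 := by
  classical
  let g : Fin n × Fin n → Sym2 V := fun p => s(f p.1, f p.2)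
  have hg : ∀ p ∈ l, ∀ q ∈ l, g p = g q → p = q := by
    intro p hp q hq hpq
    simp only [g, Sym2.eq_iff] at hpq
    rcases hpq with ⟨h1, h2⟩ | ⟨h1, h2⟩
    · exact Prod.ext (hf h1) (hf h2)
    · have := hlt p hp
      rw [hf h1, hf h2] at this
      exact absurd this (hlt q hq).asymm
  let H : G.Subgraph :=
    { verts := Set.range f
      Adj := fun a b => s(a, b) ∈ l.map g
      adj_sub := by
        intro a b h
        obtain ⟨p, hp, hpe⟩ := List.mem_map.mp h
        rw [← mem_edgeSet, ← hpe]
        exact hadj p hp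
      edge_vert := by
        intro a b h
        obtain ⟨p, hp, hpe⟩ := List.mem_map.mp h
        simp only [g, Sym2.eq_iff] at hpe
        rcases hpe with ⟨h1, -⟩ | ⟨-, h1⟩
        · exact ⟨_, h1⟩
        · exact ⟨_, h1⟩
      symm := ⟨fun a b h => by rwa [Sym2.eq_swap]⟩ }
  have hedge : H.edgeSet = ((l.map g).toFinset : Set (Sym2 V)) := by
    ext e
    induction e with
    | _ a b => simp [H]
  have h := hs H ⟨f ⟨0, hn⟩, Set.mem_range_self _⟩
  have hverts : Nat.card H.verts = n := by
    change Nat.card (Set.range f) = n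
    rw [Nat.card_range_of_injective hf, Nat.card_fin]
  rwa [hedge, hverts, Nat.card_coe_set_eq, Set.ncard_coe_finset,
    List.toFinset_card_of_nodup (List.Nodup.map_on hg hl), List.length_map] at h

lemma SimpleGraph.Connected.exists_adj_boundary {V : Type*} {G : SimpleGraph V}
    (hG : G.Connected) {S : Set V} {a : V} (ha : a ∈ S) (hS : S ≠ Set.univ) :
    ∃ x ∈ S, ∃ y ∉ S, G.Adj x y := by
  obtain ⟨b, hb⟩ := (Set.ne_univ_iff_exists_notMem S).mp hS
  obtain ⟨q⟩ := hG.preconnected a b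
  obtain ⟨d, -, h1, h2⟩ := q.exists_boundary_dart S ha hb
  exact ⟨_, h1, _, h2, d.adj⟩

lemma SimpleGraph.nonempty_iso_of_bijective {V W : Type*} {G : SimpleGraph V}
    {H : SimpleGraph W} (f : W → V) (hf : Function.Bijective f)
    (h : ∀ i j, G.Adj (f i) (f j) ↔ H.Adj i j) : Nonempty (G ≃g H) :=
  ⟨(⟨Equiv.ofBijective f hf, h _ _⟩ : H ≃g G).symm⟩

/-- Two nonadjacent neighbours of any vertex have a further common neighbour. -/
def HasFurtherCommonNeighbors {V : Type*} (G : SimpleGraph V) : Prop :=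
  ∀ ⦃v u w : V⦄, G.Adj v u → G.Adj v w → u ≠ w → ¬ G.Adj u w →
    ∃ x, x ≠ v ∧ G.Adj u x ∧ G.Adj w x

lemma Sparse.not_complete_four {V : Type*} {G : SimpleGraph V} (hs : Sparse G) {a b c d : V}
    (hab : G.Adj a b) (hac : G.Adj a c) (had : G.Adj a d) (hbc : G.Adj b c) (hbd : G.Adj b d) :
    ¬ G.Adj c d := by
  intro hcd
  have := hs.length_le (n := 4) (by simp) ![a, b, c, d]
    (List.nodup_ofFn.mp (by
      simp [hab.ne, hac.ne, had.ne, hbc.ne, hbd.ne, hcd.ne]))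
    [(0, 1), (0, 2), (0, 3), (1, 2), (1, 3), (2, 3)] (by decide) (by decide)
    (by simp [hab, hac, had, hbc, hbd, hcd])
  simp at this

/-- In a triangle `a b c`, a vertex adjacent to `a` is adjacent to another vertex of it. -/
lemma adj_of_triangle {V : Type*} {G : SimpleGraph V} (h : DistHereditary G)
    (hs : Sparse G) (hN : HasFurtherCommonNeighbors G) {a b c d : V} (hab : G.Adj a b)
    (hac : G.Adj a c) (hbc : G.Adj b c) (had : G.Adj a d) (hb : d ≠ b) :
    G.Adj d b ∨ G.Adj d c := by
  by_contra! hcon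
  obtain ⟨hdb, hdc⟩ := hcon
  obtain ⟨x, hxa, hdx, hbx⟩ := hN had hab hb hdb
  have hxc : c ≠ x := by rintro rfl; exact hdc hdx
  have hcd : c ≠ d := by rintro rfl; exact hdb hbc.symm
  have key : ∀ i : Fin 5, i = 0 ∨ i = 2 → ¬ G.Adj (![a, b, c, d, x] i) x := by
    intro i hi hix
    have := hs.length_le (n := 5) (by simp) ![a, b, c, d, x]
      (List.nodup_ofFn.mp (by
        simp [hab.ne, hac.ne, hbc.ne, had.ne, hdx.ne, hbx.ne, hb.symm, hxa.symm, hxc, hcd]))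
      [(0, 1), (0, 2), (1, 2), (0, 3), (3, 4), (1, 4), (i, 4)]
      (by clear hix; revert i; decide) (by clear hix; revert i; decide)
      (by simp [hab, hac, hbc, had, hdx, hbx, hix])
    simp at this
  exact h.not_house hab hbx hdx.symm had hac hbc (key 0 (by simp)) (fun hh => hdb hh.symm)
    (fun hh => key 2 (by simp) hh.symm) hdc

lemma not_adj_diamond {V : Type*} {G : SimpleGraph V} (h : DistHereditary G)
    (hs : Sparse G) (hN : HasFurtherCommonNeighbors G) {a b c d e : V} (hab : G.Adj a b)
    (hac : G.Adj a c) (had : G.Adj a d) (hbc : G.Adj b c) (hbd : G.Adj b d) (hcd : c ≠ d)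
    (ha : a ≠ e) (hb : b ≠ e) (hc : c ≠ e) (hd : d ≠ e) :
    ¬ G.Adj a e ∧ ¬ G.Adj c e := by
  have key : ∀ i j : Fin 5, i < j → j < 4 → G.Adj (![a, b, c, d, e] i) e →
      ¬ G.Adj (![a, b, c, d, e] j) e := by
    intro i j hij hj hie hje
    have := hs.length_le (n := 5) (by simp) ![a, b, c, d, e]
      (List.nodup_ofFn.mp (by
        simp [hab.ne, hac.ne, had.ne, hbc.ne, hbd.ne, hcd, ha, hb, hc, hd]))
      [(0, 1), (0, 2), (0, 3), (1, 2), (1, 3), (i, 4), (j, 4)]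
      (by clear hie hje; revert i j; decide) (by clear hie hje; revert i j; decide)
      (by simp [hab, hac, had, hbc, hbd, hie, hje])
    simp at this
  constructor
  · intro hae
    have nb : ¬ G.Adj b e := key 0 1 (by decide) (by decide) hae
    have nc : ¬ G.Adj c e := key 0 2 (by decide) (by decide) hae
    have nd : ¬ G.Adj d e := key 0 3 (by decide) (by decide) hae
    obtain ⟨x, hxa, hcx, hex⟩ := hN hac hae hc nc
    have hxb : b ≠ x := by rintro rfl; exact nb hex.symm
    have hxd : d ≠ x := by rintro rfl; exact nd hex.symm
    have key2 : ∀ i : Fin 6, i < 2 → ¬ G.Adj (![a, b, c, d, e, x] i) x := by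
      intro i hi hix
      have := hs.length_le (n := 6) (by simp) ![a, b, c, d, e, x]
        (List.nodup_ofFn.mp (by
          simp [hab.ne, hac.ne, had.ne, hbc.ne, hbd.ne, hcd, ha, hb, hc, hd, hxa.symm, hxb, hxd,
            hcx.ne, hex.ne]))
        [(0, 1), (0, 2), (0, 3), (1, 2), (1, 3), (0, 4), (2, 5), (4, 5), (i, 5)]
        (by clear hix; revert i; decide) (by clear hix; revert i; decide)
        (by simp [hab, hac, had, hbc, hbd, hae, hcx, hex, hix])
      simp at this
    exact h.not_house hac hcx hex.symm hae hab hbc.symm (key2 0 (by decide)) nc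
      (fun hh => key2 1 (by decide) hh.symm) (fun hh => nb hh.symm)
  · intro hce
    have na : ¬ G.Adj a e := fun hh => key 0 2 (by decide) (by decide) hh hce
    have nb : ¬ G.Adj b e := fun hh => key 1 2 (by decide) (by decide) hh hce
    have nd : ¬ G.Adj d e := key 2 3 (by decide) (by decide) hce
    obtain ⟨x, hxc, hax, hex⟩ := hN hac.symm hce ha na
    have hxb : b ≠ x := by rintro rfl; exact nb hex.symm
    have hxd : d ≠ x := by rintro rfl; exact nd hex.symm
    have key2 : ∀ i : Fin 6, i = 1 ∨ i = 2 → ¬ G.Adj (![a, b, c, d, e, x] i) x := by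
      intro i hi hix
      have := hs.length_le (n := 6) (by simp) ![a, b, c, d, e, x]
        (List.nodup_ofFn.mp (by
          simp [hab.ne, hac.ne, had.ne, hbc.ne, hbd.ne, hcd, ha, hb, hc, hd, hxc.symm, hxb, hxd,
            hax.ne, hex.ne]))
        [(0, 1), (0, 2), (0, 3), (1, 2), (1, 3), (2, 4), (0, 5), (4, 5), (i, 5)]
        (by clear hix; revert i; decide) (by clear hix; revert i; decide)
        (by simp [hab, hac, had, hbc, hbd, hce, hax, hex, hix])
      simp at this
    exact h.not_house hac hce hex hax hab hbc.symm na (key2 2 (by decide))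
      (fun hh => nb hh.symm) (fun hh => key2 1 (by decide) hh.symm)

/-- `a, b` and `c, d, e` are the sides of a (not necessarily induced) `K_{2,3}`. -/
structure IsK23 {V : Type*} (G : SimpleGraph V) (a b c d e : V) : Prop where
  ne_ab : a ≠ b
  ne_cd : c ≠ d
  ne_ce : c ≠ e
  ne_de : d ≠ e
  ac : G.Adj a c
  ad : G.Adj a d
  ae : G.Adj a e
  bc : G.Adj b c
  bd : G.Adj b d
  be : G.Adj b e

namespace IsK23

variable {V : Type*} {G : SimpleGraph V} {a b c d e f : V}

lemma swap (k : IsK23 G a b c d e) : IsK23 G b a c d e :=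
  ⟨k.ne_ab.symm, k.ne_cd, k.ne_ce, k.ne_de, k.bc, k.bd, k.be, k.ac, k.ad, k.ae⟩

lemma rotate (k : IsK23 G a b c d e) : IsK23 G a b d e c :=
  ⟨k.ne_ab, k.ne_de, k.ne_cd.symm, k.ne_ce.symm, k.ad, k.ae, k.ac, k.bd, k.be, k.bc⟩

lemma not_adj_left (k : IsK23 G a b c d e) (h : DistHereditary G) (hs : Sparse G)
    (hN : HasFurtherCommonNeighbors G) (ht : ∀ x y z, G.Adj x y → G.Adj y z → ¬ G.Adj x z)
    (hK : IsEmpty (completeBipartiteGraph (Fin 2) (Fin 4) ↪g G))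
    (hb : b ≠ f) (hc : c ≠ f) (hd : d ≠ f) (he : e ≠ f) : ¬ G.Adj a f := by
  intro haf
  obtain ⟨hab, hcd, hce, hde, ac, ad, ae, bc, bd, be⟩ := k
  have nab := ht a c b ac bc.symm
  have ncd := ht c a d ac.symm ad
  have nce := ht c a e ac.symm ae
  have nde := ht d a e ad.symm ae
  have ncf := ht c a f ac.symm haf
  have ndf := ht d a f ad.symm haf
  have nef := ht e a f ae.symm haf
  have nbf : ¬ G.Adj b f := by
    intro hbf
    refine hK.false ⟨⟨Sum.elim ![a, b] ![c, d, e, f], ?_⟩, ?_⟩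
    · rw [Sum.elim_injective]
      refine ⟨List.nodup_ofFn.mp (by simp [hab]),
        List.nodup_ofFn.mp (by simp [hcd, hce, hde, hc, hd, he]), ?_⟩
      simp [Fin.forall_fin_succ, ac.ne, ad.ne, ae.ne, bc.ne, bd.ne, be.ne, haf.ne, hbf.ne]
    · simp [Fin.forall_fin_succ, ac, ad, ae, bc, bd, be, haf, hbf, nab, ncd, nce, nde, ncf, ndf,
        nef, G.adj_comm b a, G.adj_comm c a, G.adj_comm d a, G.adj_comm e a, G.adj_comm f a,
        G.adj_comm c b, G.adj_comm d b, G.adj_comm e b, G.adj_comm f b, G.adj_comm d c,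
        G.adj_comm e c, G.adj_comm f c, G.adj_comm e d, G.adj_comm f d, G.adj_comm f e]
  obtain ⟨x, hxa, hcx, hfx⟩ := hN ac haf hc ncf
  have hbx : b ≠ x := by rintro rfl; exact nbf hfx.symm
  have hdx : d ≠ x := by rintro rfl; exact ndf hfx.symm
  have hex : e ≠ x := by rintro rfl; exact nef hfx.symm
  have ndx : ¬ G.Adj d x := by
    intro hadj
    have := hs.length_le (n := 7) (by simp) ![a, b, c, d, e, f, x]
      (List.nodup_ofFn.mp (by
        simp [hab, ac.ne, ad.ne, ae.ne, haf.ne, hxa.symm, bc.ne, bd.ne, be.ne, hb, hbx, hcd, hce,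
          hc, hcx.ne, hde, hd, hdx, he, hex, hfx.ne]))
      [(0, 2), (0, 3), (0, 4), (1, 2), (1, 3), (1, 4), (0, 5), (5, 6), (2, 6), (3, 6)]
      (by decide) (by decide) (by simp [ac, ad, ae, bc, bd, be, haf, hfx, hcx, hadj])
    simp at this
  exact h.not_domino ad.symm ac bc.symm bd.symm haf hfx hcx (fun hh => ncd hh.symm) nab
    ndf ndx (ht a f x haf hfx) ncf nbf (ht b c x bc hcx)

lemma adj_right (k : IsK23 G a b c d e) (h : DistHereditary G) (hs : Sparse G)
    (hN : HasFurtherCommonNeighbors G) (ht : ∀ x y z, G.Adj x y → G.Adj y z → ¬ G.Adj x z)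
    (hK : IsEmpty (completeBipartiteGraph (Fin 2) (Fin 4) ↪g G))
    (ha : a ≠ f) (hb : b ≠ f) (hd : d ≠ f) (he : e ≠ f) (hcf : G.Adj c f) :
    G.Adj d f ∧ ¬ G.Adj e f ∨ G.Adj e f ∧ ¬ G.Adj d f := by
  by_cases hdf : G.Adj d f <;> by_cases hef : G.Adj e f
  · have := hs.length_le (n := 6) (by simp) ![a, b, c, d, e, f]
      (List.nodup_ofFn.mp (by
        simp [k.ne_ab, k.ac.ne, k.ad.ne, k.ae.ne, ha, k.bc.ne, k.bd.ne, k.be.ne, hb, k.ne_cd,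
          k.ne_ce, hcf.ne, k.ne_de, hd, he]))
      [(0, 2), (0, 3), (0, 4), (1, 2), (1, 3), (1, 4), (2, 5), (3, 5), (4, 5)]
      (by decide) (by decide)
      (by simp [k.ac, k.ad, k.ae, k.bc, k.bd, k.be, hcf, hdf, hef])
    simp at this
  · simp [hdf, hef]
  · simp [hdf, hef]
  · exfalso
    obtain ⟨x, hxc, hax, hfx⟩ := hN k.ac.symm hcf ha (ht a c f k.ac hcf)
    refine k.not_adj_left (f := x) h hs hN ht hK ?_ hxc.symm ?_ ?_ hax
    · rintro rfl; exact ht _ c f k.bc hcf hfx.symm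
    · rintro rfl; exact hdf hfx.symm
    · rintro rfl; exact hef hfx.symm

end IsK23

lemma IsK23.iso_K33minus {V : Type*} {G : SimpleGraph V} {a b c d e f : V}
    (k : IsK23 G a b c d e) (hG : G.Connected) (h : DistHereditary G) (hs : Sparse G)
    (hN : HasFurtherCommonNeighbors G) (ht : ∀ x y z, G.Adj x y → G.Adj y z → ¬ G.Adj x z)
    (hK : IsEmpty (completeBipartiteGraph (Fin 2) (Fin 4) ↪g G))
    (ha : a ≠ f) (hb : b ≠ f) (he : e ≠ f) (hcf : G.Adj c f) (hdf : G.Adj d f)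
    (hef : ¬ G.Adj e f) : Nonempty (G ≃g K33minus) := by
  have k' : IsK23 G c d a b f := ⟨k.ne_cd, k.ne_ab, ha, hb, k.ac.symm, k.bc.symm, hcf,
    k.ad.symm, k.bd.symm, hdf⟩
  have hall : ∀ y, y = a ∨ y = b ∨ y = c ∨ y = d ∨ y = e ∨ y = f := by
    by_contra! hcon
    obtain ⟨z, hz⟩ := hcon
    obtain ⟨x, hx, g, hg, hxg⟩ := hG.exists_adj_boundary (S := {a, b, c, d, e, f}) (a := a)
      (by simp) (fun hS => by
        have := hS ▸ Set.mem_univ z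
        simp [hz] at this)
    simp only [Set.mem_insert_iff, Set.mem_singleton_iff, not_or] at hx hg
    obtain ⟨ga, gb, gc, gd, ge, gf⟩ := hg
    have na := k.not_adj_left h hs hN ht hK (Ne.symm gb) (Ne.symm gc) (Ne.symm gd) (Ne.symm ge)
    have nb := k.swap.not_adj_left h hs hN ht hK (Ne.symm ga) (Ne.symm gc) (Ne.symm gd)
      (Ne.symm ge)
    have nc := k'.not_adj_left h hs hN ht hK (Ne.symm gd) (Ne.symm ga) (Ne.symm gb) (Ne.symm gf)
    have nd := k'.swap.not_adj_left h hs hN ht hK (Ne.symm gc) (Ne.symm ga) (Ne.symm gb)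
      (Ne.symm gf)
    rcases hx with rfl | rfl | rfl | rfl | rfl | rfl
    · exact na hxg
    · exact nb hxg
    · exact nc hxg
    · exact nd hxg
    · rcases k.rotate.rotate.adj_right h hs hN ht hK (Ne.symm ga) (Ne.symm gb) (Ne.symm gc)
        (Ne.symm gd) hxg with ⟨h1, -⟩ | ⟨h1, -⟩
      · exact nc h1
      · exact nd h1
    · rcases k'.rotate.rotate.adj_right h hs hN ht hK (Ne.symm gc) (Ne.symm gd) (Ne.symm ga)
        (Ne.symm gb) hxg with ⟨h1, -⟩ | ⟨h1, -⟩
      · exact na h1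
      · exact nb h1
  obtain ⟨hab, hcd, hce, hde, ac, ad, ae, bc, bd, be⟩ := k
  have nab := ht a c b ac bc.symm
  have ncd := ht c a d ac.symm ad
  have nce := ht c a e ac.symm ae
  have nde := ht d a e ad.symm ae
  have naf := ht a c f ac hcf
  have nbf := ht b c f bc hcf
  refine nonempty_iso_of_bijective (Sum.elim ![f, a, b] ![e, c, d]) ⟨?_, ?_⟩ ?_
  · rw [Sum.elim_injective]
    refine ⟨List.nodup_ofFn.mp (by simp [hab, ha.symm, hb.symm]),
      List.nodup_ofFn.mp (by simp [hcd, hce.symm, hde.symm]), ?_⟩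
    simp [Fin.forall_fin_succ, ac.ne, ad.ne, ae.ne, bc.ne, bd.ne, be.ne, hcf.ne', hdf.ne',
      he.symm]
  · intro y
    rcases hall y with rfl | rfl | rfl | rfl | rfl | rfl
    · exact ⟨.inl 1, rfl⟩
    · exact ⟨.inl 2, rfl⟩
    · exact ⟨.inr 1, rfl⟩
    · exact ⟨.inr 2, rfl⟩
    · exact ⟨.inr 0, rfl⟩
    · exact ⟨.inl 0, rfl⟩
  · simp [Fin.forall_fin_succ, K33minus, ac, ad, ae, bc, bd, be, hcf, hdf, hef, nab, ncd, nce,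
      nde, naf, nbf, G.adj_comm b a, G.adj_comm c a, G.adj_comm d a, G.adj_comm e a,
      G.adj_comm f a, G.adj_comm c b, G.adj_comm d b, G.adj_comm e b, G.adj_comm f b,
      G.adj_comm d c, G.adj_comm e c, G.adj_comm f c, G.adj_comm e d, G.adj_comm f d,
      G.adj_comm f e]

lemma IsK23.iso_or {V : Type*} {G : SimpleGraph V} {a b c d e : V}
    (k : IsK23 G a b c d e) (hG : G.Connected) (h : DistHereditary G) (hs : Sparse G)
    (hN : HasFurtherCommonNeighbors G) (ht : ∀ x y z, G.Adj x y → G.Adj y z → ¬ G.Adj x z)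
    (hK : IsEmpty (completeBipartiteGraph (Fin 2) (Fin 4) ↪g G)) :
    Nonempty (G ≃g completeBipartiteGraph (Fin 2) (Fin 3)) ∨ Nonempty (G ≃g K33minus) := by
  by_cases hall : ∀ y, y = a ∨ y = b ∨ y = c ∨ y = d ∨ y = e
  · left
    obtain ⟨hab, hcd, hce, hde, ac, ad, ae, bc, bd, be⟩ := k
    have nab := ht a c b ac bc.symm
    have ncd := ht c a d ac.symm ad
    have nce := ht c a e ac.symm ae
    have nde := ht d a e ad.symm ae
    refine nonempty_iso_of_bijective (Sum.elim ![a, b] ![c, d, e]) ⟨?_, ?_⟩ ?_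
    · rw [Sum.elim_injective]
      refine ⟨List.nodup_ofFn.mp (by simp [hab]), List.nodup_ofFn.mp (by simp [hcd, hce, hde]), ?_⟩
      simp [Fin.forall_fin_succ, ac.ne, ad.ne, ae.ne, bc.ne, bd.ne, be.ne]
    · intro y
      rcases hall y with rfl | rfl | rfl | rfl | rfl
      · exact ⟨.inl 0, rfl⟩
      · exact ⟨.inl 1, rfl⟩
      · exact ⟨.inr 0, rfl⟩
      · exact ⟨.inr 1, rfl⟩
      · exact ⟨.inr 2, rfl⟩
    · simp [Fin.forall_fin_succ, ac, ad, ae, bc, bd, be, nab, ncd, nce, nde, G.adj_comm b a,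
        G.adj_comm c a, G.adj_comm d a, G.adj_comm e a, G.adj_comm c b, G.adj_comm d b,
        G.adj_comm e b, G.adj_comm d c, G.adj_comm e c, G.adj_comm e d]
  · right
    push Not at hall
    obtain ⟨z, hz⟩ := hall
    obtain ⟨x, hx, f, hf, hxf⟩ := hG.exists_adj_boundary (S := {a, b, c, d, e}) (a := a)
      (by simp) (fun hS => by
        have := hS ▸ Set.mem_univ z
        simp [hz] at this)
    simp only [Set.mem_insert_iff, Set.mem_singleton_iff, not_or] at hx hf
    obtain ⟨fa, fb, fc, fd, fe⟩ := hf
    have main : ∀ {c d e : V}, IsK23 G a b c d e → d ≠ f → e ≠ f → G.Adj c f →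
        Nonempty (G ≃g K33minus) := by
      intro c d e k hd he hcf
      rcases k.adj_right h hs hN ht hK (Ne.symm fa) (Ne.symm fb) hd he hcf
        with ⟨h1, h2⟩ | ⟨h1, h2⟩
      · exact k.iso_K33minus hG h hs hN ht hK (Ne.symm fa) (Ne.symm fb) he hcf h1 h2
      · exact k.rotate.rotate.iso_K33minus hG h hs hN ht hK (Ne.symm fa) (Ne.symm fb) hd h1 hcf h2
    rcases hx with rfl | rfl | rfl | rfl | rfl
    · exact absurd hxf (k.not_adj_left h hs hN ht hK (Ne.symm fb) (Ne.symm fc) (Ne.symm fd)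
        (Ne.symm fe))
    · exact absurd hxf (k.swap.not_adj_left h hs hN ht hK (Ne.symm fa) (Ne.symm fc) (Ne.symm fd)
        (Ne.symm fe))
    · exact main k (Ne.symm fd) (Ne.symm fe) hxf
    · exact main k.rotate (Ne.symm fe) (Ne.symm fc) hxf
    · exact main k.rotate.rotate (Ne.symm fc) (Ne.symm fd) hxf

lemma iso_of_diamond {V : Type*} {G : SimpleGraph V} (hG : G.Connected) (h : DistHereditary G)
    (hs : Sparse G) (hN : HasFurtherCommonNeighbors G) {a b c d : V} (hab : G.Adj a b)
    (hac : G.Adj a c) (had : G.Adj a d) (hbc : G.Adj b c) (hbd : G.Adj b d) (hcd : c ≠ d) :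
    Nonempty (G ≃g diamondGraph) := by
  have hall : ∀ y, y = a ∨ y = b ∨ y = c ∨ y = d := by
    by_contra! hcon
    obtain ⟨z, hz⟩ := hcon
    obtain ⟨x, hx, e, he, hxe⟩ := hG.exists_adj_boundary (S := {a, b, c, d}) (a := a)
      (by simp) (fun hS => by
        have := hS ▸ Set.mem_univ z
        simp [hz] at this)
    simp only [Set.mem_insert_iff, Set.mem_singleton_iff, not_or] at hx he
    obtain ⟨ea, eb, ec, ed⟩ := he
    rcases hx with rfl | rfl | rfl | rfl
    · exact (not_adj_diamond h hs hN hab hac had hbc hbd hcd (Ne.symm ea) (Ne.symm eb)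
        (Ne.symm ec) (Ne.symm ed)).1 hxe
    · exact (not_adj_diamond h hs hN hab.symm hbc hbd hac had hcd (Ne.symm eb) (Ne.symm ea)
        (Ne.symm ec) (Ne.symm ed)).1 hxe
    · exact (not_adj_diamond h hs hN hab hac had hbc hbd hcd (Ne.symm ea) (Ne.symm eb)
        (Ne.symm ec) (Ne.symm ed)).2 hxe
    · exact (not_adj_diamond h hs hN hab had hac hbd hbc hcd.symm (Ne.symm ea) (Ne.symm eb)
        (Ne.symm ed) (Ne.symm ec)).2 hxe
  have ncd := hs.not_complete_four hab hac had hbc hbd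
  refine nonempty_iso_of_bijective ![a, c, b, d] ⟨List.nodup_ofFn.mp ?_, ?_⟩ ?_
  · simp [hab.ne, hac.ne, had.ne, hbc.ne', hbd.ne, hcd]
  · intro y
    rcases hall y with rfl | rfl | rfl | rfl
    · exact ⟨0, rfl⟩
    · exact ⟨2, rfl⟩
    · exact ⟨1, rfl⟩
    · exact ⟨3, rfl⟩
  · simp only [Fin.forall_fin_succ]
    simp [diamondGraph, hab, hac, had, hbc, hbd, ncd, G.adj_comm b a, G.adj_comm c a,
      G.adj_comm d a, G.adj_comm c b, G.adj_comm d b, G.adj_comm d c]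

lemma iso_of_triangle {V : Type*} {G : SimpleGraph V} (hG : G.Connected) (h : DistHereditary G)
    (hs : Sparse G) (hN : HasFurtherCommonNeighbors G) {a b c : V} (hab : G.Adj a b)
    (hac : G.Adj a c) (hbc : G.Adj b c) :
    Nonempty (G ≃g triangleGraph) ∨ Nonempty (G ≃g diamondGraph) := by
  by_cases hall : ∀ y, y = a ∨ y = b ∨ y = c
  · left
    refine nonempty_iso_of_bijective ![a, b, c] ⟨List.nodup_ofFn.mp ?_, ?_⟩ ?_
    · simp [hab.ne, hac.ne, hbc.ne]
    · intro y
      rcases hall y with rfl | rfl | rfl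
      · exact ⟨0, rfl⟩
      · exact ⟨1, rfl⟩
      · exact ⟨2, rfl⟩
    · simp [Fin.forall_fin_succ, triangleGraph, hab, hac, hbc, hab.symm, hac.symm, hbc.symm]
  · right
    push Not at hall
    obtain ⟨z, hz⟩ := hall
    obtain ⟨x, hx, d, hd, hxd⟩ := hG.exists_adj_boundary (S := {a, b, c}) (a := a)
      (by simp) (fun hS => by
        have := hS ▸ Set.mem_univ z
        simp [hz] at this)
    simp only [Set.mem_insert_iff, Set.mem_singleton_iff, not_or] at hx hd
    obtain ⟨da, db, dc⟩ := hd
    have main : ∀ {a b c : V}, G.Adj a b → G.Adj a c → G.Adj b c → d ≠ b → d ≠ c →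
        G.Adj a d → Nonempty (G ≃g diamondGraph) := by
      intro a b c hab hac hbc db dc had
      rcases adj_of_triangle h hs hN hab hac hbc had db with hh | hh
      · exact iso_of_diamond hG h hs hN hab hac had hbc hh.symm dc.symm
      · exact iso_of_diamond hG h hs hN hac hab had hbc.symm hh.symm db.symm
    rcases hx with rfl | rfl | rfl
    · exact main hab hac hbc db dc hxd
    · exact main hab.symm hbc hac da dc hxd
    · exact main hac.symm hbc.symm hab da db hxd

lemma iso_of_square {V : Type*} {G : SimpleGraph V} (hG : G.Connected) (h : DistHereditary G)
    (hs : Sparse G) (hN : HasFurtherCommonNeighbors G)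
    (ht : ∀ x y z, G.Adj x y → G.Adj y z → ¬ G.Adj x z)
    (hK : IsEmpty (completeBipartiteGraph (Fin 2) (Fin 4) ↪g G)) {a b c d : V}
    (hab : G.Adj a b) (hbc : G.Adj b c) (hcd : G.Adj c d) (had : G.Adj a d) (hac : a ≠ c)
    (hbd : b ≠ d) :
    Nonempty (G ≃g cycleGraph 4) ∨ Nonempty (G ≃g completeBipartiteGraph (Fin 2) (Fin 3)) ∨
      Nonempty (G ≃g K33minus) := by
  by_cases hall : ∀ y, y = a ∨ y = b ∨ y = c ∨ y = d
  · left
    have nac := ht a b c hab hbc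
    have nbd := ht b c d hbc hcd
    refine nonempty_iso_of_bijective ![a, b, c, d] ⟨List.nodup_ofFn.mp ?_, ?_⟩ ?_
    · simp [hab.ne, hac, had.ne, hbc.ne, hbd, hcd.ne]
    · intro y
      rcases hall y with rfl | rfl | rfl | rfl
      · exact ⟨0, rfl⟩
      · exact ⟨1, rfl⟩
      · exact ⟨2, rfl⟩
      · exact ⟨3, rfl⟩
    · have e : ∀ i j : Fin 4, (cycleGraph 4).Adj i j ↔ i - j = 1 ∨ j - i = 1 := fun _ _ =>
        cycleGraph_adj
      simp only [Fin.forall_fin_succ, e]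
      simp [hab, hbc, hcd, had, nac, nbd, G.adj_comm b a, G.adj_comm c a,
        G.adj_comm d a, G.adj_comm c b, G.adj_comm d b, G.adj_comm d c]
      decide
  · right
    push Not at hall
    obtain ⟨z, hz⟩ := hall
    obtain ⟨x, hx, e, he, hxe⟩ := hG.exists_adj_boundary (S := {a, b, c, d}) (a := a)
      (by simp) (fun hS => by
        have := hS ▸ Set.mem_univ z
        simp [hz] at this)
    simp only [Set.mem_insert_iff, Set.mem_singleton_iff, not_or] at hx he
    obtain ⟨ea, eb, ec, ed⟩ := he
    suffices hex : ∃ a b c d e, IsK23 G a b c d e by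
      obtain ⟨_, _, _, _, _, k⟩ := hex
      exact k.iso_or hG h hs hN ht hK
    have main : ∀ {a b c d : V}, G.Adj a b → G.Adj b c → G.Adj c d → G.Adj a d → a ≠ c →
        b ≠ d → b ≠ e → d ≠ e → G.Adj a e → ∃ a b c d e, IsK23 G a b c d e := by
      intro a b c d hab hbc hcd had hac hbd eb ed hae
      by_contra! hcon
      have nbe := ht b a e hab.symm hae
      have nde := ht d a e had.symm hae
      have nce : ¬ G.Adj c e := fun hh =>
        hcon a c b d e ⟨hac, hbd, eb, ed, hab, had, hae, hbc.symm, hcd, hh⟩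
      obtain ⟨x, hxa, hbx, hex⟩ := hN hab hae eb nbe
      have ndx : ¬ G.Adj d x := fun hh =>
        hcon b d a c x ⟨hbd, hac, hxa.symm, by rintro rfl; exact nce hex.symm, hab.symm, hbc,
          hbx, had.symm, hcd.symm, hh⟩
      exact h.not_domino had.symm hab hbc hcd.symm hae hex hbx
        (fun hh => ht b c d hbc hcd hh.symm) (ht a b c hab hbc) nde ndx (ht a b x hab hbx) nbe
        nce (ht c b x hbc.symm hbx)
    rcases hx with rfl | rfl | rfl | rfl
    · exact main hab hbc hcd had hac hbd (Ne.symm eb) (Ne.symm ed) hxe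
    · exact main hbc hcd had.symm hab.symm hbd hac.symm (Ne.symm ec) (Ne.symm ea) hxe
    · exact main hcd had.symm hab hbc.symm hac.symm hbd.symm (Ne.symm ed) (Ne.symm eb) hxe
    · exact main had.symm hab hbc hcd.symm hbd.symm hac (Ne.symm ea) (Ne.symm ec) hxe

/-- A sparse `K_{2,4}`-free 2-connected distance-hereditary graph is one of five graphs. -/
lemma DistHereditary.classification {V : Type*} {G : SimpleGraph V} (h : DistHereditary G)
    (h2 : TwoConnected G) (hs : Sparse G)
    (hK : IsEmpty (completeBipartiteGraph (Fin 2) (Fin 4) ↪g G)) :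
    Nonempty (G ≃g triangleGraph) ∨ Nonempty (G ≃g SimpleGraph.cycleGraph 4) ∨
      Nonempty (G ≃g diamondGraph) ∨
      Nonempty (G ≃g completeBipartiteGraph (Fin 2) (Fin 3)) ∨
      Nonempty (G ≃g K33minus) := by
  have hN : HasFurtherCommonNeighbors G := fun v u w => h.exists_common_neighbor h2
  have hG := h2.1
  by_cases htri : ∃ a b c, G.Adj a b ∧ G.Adj b c ∧ G.Adj a c
  · obtain ⟨a, b, c, hab, hbc, hac⟩ := htri
    rcases iso_of_triangle hG h hs hN hab hac hbc with hh | hh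
    · exact .inl hh
    · exact .inr (.inr (.inl hh))
  · have ht : ∀ x y z, G.Adj x y → G.Adj y z → ¬ G.Adj x z := fun x y z hxy hyz hxz =>
      htri ⟨x, y, z, hxy, hyz, hxz⟩
    have hS : ∀ a b : V, ({a, b} : Set V) ≠ Set.univ := by
      intro a b hS
      have h3 := h2.2.1
      rw [← Set.ncard_univ, ← hS] at h3
      have := Set.ncard_insert_le a {b}
      rw [Set.ncard_singleton] at this
      omega
    have hpath : ∃ a b c, G.Adj a b ∧ G.Adj a c ∧ b ≠ c := by
      obtain ⟨a⟩ := hG.nonempty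
      obtain ⟨x, hx, b, hb, hxb⟩ := hG.exists_adj_boundary (S := {a, a}) (a := a) (by simp) (hS a a)
      obtain ⟨y, hy, c, hc, hyc⟩ := hG.exists_adj_boundary (S := {x, b}) (a := x) (by simp) (hS x b)
      simp only [Set.mem_insert_iff, Set.mem_singleton_iff, not_or] at hy hc
      rcases hy with rfl | rfl
      · exact ⟨y, b, c, hxb, hyc, Ne.symm hc.2⟩
      · exact ⟨y, x, c, hxb.symm, hyc, Ne.symm hc.1⟩
    obtain ⟨a, b, c, hab, hac, hbc⟩ := hpath
    obtain ⟨x, hxa, hbx, hcx⟩ := hN hab hac hbc (ht b a c hab.symm hac)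
    rcases iso_of_square hG h hs hN ht hK hab hbx hcx.symm hac hxa.symm hbc with hh | hh | hh
    · exact .inr (.inl hh)
    · exact .inr (.inr (.inr (.inl hh)))
    · exact .inr (.inr (.inr (.inr hh)))

/-- A graph is matching-decyclable if its vertices can be labelled injectively so that every
vertex has at most one neighbour whose label is not consecutive with its own. -/
lemma MDecyclable.of_labelling {V W : Type*} {G : SimpleGraph V} {H : SimpleGraph W} (φ : G ≃g H)
    (r : W → ℕ) (hr : Function.Injective r)
    (hH : ∀ u v w, H.Adj u v → H.Adj u w → r u ≠ r v + 1 → r v ≠ r u + 1 →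
      r u ≠ r w + 1 → r w ≠ r u + 1 → v = w) : MDecyclable G := by
  let K : SimpleGraph V := SimpleGraph.fromRel fun u v => r (φ u) = r (φ v) + 1
  have hK : ∀ u v, K.Adj u v ↔ r (φ u) = r (φ v) + 1 ∨ r (φ v) = r (φ u) + 1 := by
    intro u v
    simp only [K, SimpleGraph.fromRel_adj]
    refine ⟨fun h => h.2, fun h => ⟨?_, h⟩⟩
    rintro rfl
    omega
  refine ⟨G.edgeSet \ K.edgeSet, ⟨Set.sdiff_subset, ?_⟩, ?_⟩
  · intro e he f hf hef v hve hvf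
    obtain ⟨x, rfl⟩ := Sym2.mem_iff_exists.1 hve
    obtain ⟨y, rfl⟩ := Sym2.mem_iff_exists.1 hvf
    simp only [Set.mem_sdiff, SimpleGraph.mem_edgeSet, hK, not_or] at he hf
    apply hef
    rw [φ.injective (hH (φ v) (φ x) (φ y) (φ.map_adj_iff.2 he.1) (φ.map_adj_iff.2 hf.1)
      he.2.1 he.2.2 hf.2.1 hf.2.2)]
  · have hKa : K.IsAcyclic := by
      rw [SimpleGraph.isAcyclic_iff_forall_adj_isBridge]
      have key : ∀ u v, r (φ v) = r (φ u) + 1 → K.IsBridge s(u, v) := by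
        rintro u v huv
        rw [SimpleGraph.isBridge_iff]
        rintro ⟨p⟩
        obtain ⟨d, -, h1, h2⟩ := p.exists_boundary_dart {x | r (φ x) ≤ r (φ u)}
          (by simp) (by simp [huv])
        have had := d.adj
        simp only [SimpleGraph.deleteEdges_adj, hK, Set.mem_ofPred_eq, Set.mem_singleton_iff]
          at had h1 h2
        apply had.2
        have e1 : d.fst = u := φ.injective (hr (by omega))
        have e2 : d.snd = v := φ.injective (hr (by omega))
        rw [e1, e2]
      intro u v huv
      rcases (hK u v).1 huv with h | h
      · rw [Sym2.eq_swap]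
        exact key v u h
      · exact key u v h
    refine hKa.anti fun u v huv => ?_
    by_contra hn
    exact (SimpleGraph.deleteEdges_adj.1 huv).2 ⟨(SimpleGraph.deleteEdges_adj.1 huv).1, hn⟩

set_option synthInstance.maxSize 1000 in
/-- Each of the five exceptional graphs is matching-decyclable. -/
lemma MDecyclable.of_iso {V : Type*} {G : SimpleGraph V}
    (h : Nonempty (G ≃g triangleGraph) ∨ Nonempty (G ≃g SimpleGraph.cycleGraph 4) ∨
      Nonempty (G ≃g diamondGraph) ∨
      Nonempty (G ≃g completeBipartiteGraph (Fin 2) (Fin 3)) ∨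
      Nonempty (G ≃g K33minus)) : MDecyclable G := by
  rcases h with ⟨⟨φ⟩⟩ | ⟨⟨φ⟩⟩ | ⟨⟨φ⟩⟩ | ⟨⟨φ⟩⟩ | ⟨⟨φ⟩⟩
  · refine .of_labelling φ (fun i => i) Fin.val_injective ?_
    simp only [triangleGraph, SimpleGraph.top_adj]
    decide
  · refine .of_labelling φ (fun i => i) Fin.val_injective ?_
    decide
  · refine .of_labelling φ ![2, 0, 1, 3] (by decide) ?_
    have e : ∀ i j, diamondGraph.Adj i j ↔
        s(i, j) ∈ ({s(0,1), s(0,2), s(0,3), s(1,2), s(2,3)} : Finset (Sym2 (Fin 4))) ∧ i ≠ j := by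
      intro i j
      simp [diamondGraph]
    simp only [e]
    decide
  · refine .of_labelling φ (Sum.elim ![1, 3] ![2, 4, 0]) (by decide) ?_
    simp only [completeBipartiteGraph_adj]
    decide
  · refine .of_labelling φ (Sum.elim ![0, 4, 2] ![5, 3, 1]) (by decide) ?_
    have e : ∀ i j, K33minus.Adj i j ↔ (completeBipartiteGraph (Fin 3) (Fin 3)).Adj i j ∧
        s(i, j) ≠ s(.inl 0, .inr 0) := by
      intro i j
      simp only [K33minus, SimpleGraph.fromEdgeSet_adj, Set.mem_ofPred_eq,
        SimpleGraph.mem_edgeSet, and_iff_left_iff_imp]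
      exact fun h => h.1.ne
    simp only [e, completeBipartiteGraph_adj]
    decide

/-- A matching-decyclable graph has no induced `K_{2,4}`. -/
lemma MDecyclable.isEmpty_embedding {V : Type*} {G : SimpleGraph V} (h : MDecyclable G) :
    IsEmpty (completeBipartiteGraph (Fin 2) (Fin 4) ↪g G) := by
  refine ⟨fun φ => ?_⟩
  obtain ⟨M, ⟨-, hM⟩, hA⟩ := h
  have hex : ∀ i : Fin 2, ∃ k : Fin 4, ∀ j, j ≠ k →
      (G.deleteEdges M).Adj (φ (.inl i)) (φ (.inr j)) := by
    intro i
    by_cases hi : ∃ k : Fin 4, s(φ (.inl i), φ (.inr k)) ∈ M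
    · obtain ⟨k, hk⟩ := hi
      refine ⟨k, fun j hj => ?_⟩
      rw [SimpleGraph.deleteEdges_adj]
      refine ⟨φ.map_adj_iff.2 (by simp), fun hjM => ?_⟩
      refine hM _ hk _ hjM ?_ (φ (.inl i)) (by simp) (by simp)
      simp [hj.symm]
    · push Not at hi
      refine ⟨0, fun j _ => ?_⟩
      rw [SimpleGraph.deleteEdges_adj]
      exact ⟨φ.map_adj_iff.2 (by simp), hi j⟩
  obtain ⟨k₀, h₀⟩ := hex 0
  obtain ⟨k₁, h₁⟩ := hex 1
  have hp : ∀ k l : Fin 4, ∃ i j, i ≠ j ∧ i ≠ k ∧ i ≠ l ∧ j ≠ k ∧ j ≠ l := by decide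
  obtain ⟨i, j, hij, hi0, hi1, hj0, hj1⟩ := hp k₀ k₁
  have hb := SimpleGraph.isAcyclic_iff_forall_adj_isBridge.1 hA (h₀ i hi0)
  rw [SimpleGraph.isBridge_iff] at hb
  apply hb
  have a1 : ((G.deleteEdges M).deleteEdges {s(φ (.inl 0), φ (.inr i))}).Adj
      (φ (.inl 0)) (φ (.inr j)) := by
    rw [SimpleGraph.deleteEdges_adj]
    refine ⟨h₀ j hj0, ?_⟩
    simp [hij.symm]
  have a2 : ((G.deleteEdges M).deleteEdges {s(φ (.inl 0), φ (.inr i))}).Adj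
      (φ (.inl 1)) (φ (.inr j)) := by
    rw [SimpleGraph.deleteEdges_adj]
    refine ⟨h₁ j hj1, ?_⟩
    simp [hij.symm]
  have a3 : ((G.deleteEdges M).deleteEdges {s(φ (.inl 0), φ (.inr i))}).Adj
      (φ (.inl 1)) (φ (.inr i)) := by
    rw [SimpleGraph.deleteEdges_adj]
    refine ⟨h₁ i hi1, ?_⟩
    simp
  exact a1.reachable.trans (a2.symm.reachable.trans a3.reachable)

/-- An acyclic graph on a finite nonempty vertex set has fewer edges than vertices. -/
lemma SimpleGraph.IsAcyclic.ncard_edgeSet_lt {V : Type*} [Finite V] [Nonempty V]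
    {G : SimpleGraph V} (h : G.IsAcyclic) : G.edgeSet.ncard < Nat.card V := by
  classical
  have := Fintype.ofFinite V
  obtain ⟨F, hGF, -, hF⟩ := (SimpleGraph.connected_top (V := V)).exists_isTree_le_of_le_of_isAcyclic
    le_top h
  have h1 := hF.card_edgeFinset
  have h2 : G.edgeSet.ncard ≤ F.edgeSet.ncard :=
    Set.ncard_le_ncard (SimpleGraph.edgeSet_mono hGF) (Set.toFinite _)
  rw [← SimpleGraph.coe_edgeFinset F, Set.ncard_coe_finset] at h2
  rw [Nat.card_eq_fintype_card]
  omega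

/-- A family of pairwise disjoint edges has at most half as many members as there are
vertices. -/
lemma two_mul_ncard_le {V : Type*} [Finite V] {G : SimpleGraph V} {M : Set (Sym2 V)}
    (hM : IsMatchingIn G M) : 2 * M.ncard ≤ Nat.card V := by
  classical
  have := Fintype.ofFinite V
  have hc : (M.toFinset.biUnion Sym2.toFinset).card = ∑ e ∈ M.toFinset, 2 := by
    rw [Finset.card_biUnion]
    · refine Finset.sum_congr rfl fun e he => ?_
      exact Sym2.card_toFinset_of_not_isDiag e (G.not_isDiag_of_mem_edgeSet (hM.1 (by simpa using he)))
    · intro e he f hf hef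
      rw [Function.onFun, Finset.disjoint_left]
      intro v hv hv'
      exact hM.2 e (by simpa using he) f (by simpa using hf) hef v (by simpa using hv)
        (by simpa using hv')
  have := Finset.card_le_univ (M.toFinset.biUnion Sym2.toFinset)
  rw [hc, Finset.sum_const, smul_eq_mul, ← Set.ncard_eq_toFinset_card'] at this
  rw [Nat.card_eq_fintype_card]
  omega

/-- A matching-decyclable graph on `n > 0` vertices has fewer than `3n/2` edges. -/
lemma MDecyclable.ncard_edgeSet_le {V : Type*} [Finite V] [Nonempty V] {G : SimpleGraph V}
    (h : MDecyclable G) : G.edgeSet.ncard ≤ 3 * Nat.card V / 2 - 1 := by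
  obtain ⟨M, hM, hA⟩ := h
  have h1 := two_mul_ncard_le hM
  have h2 := hA.ncard_edgeSet_lt
  rw [SimpleGraph.edgeSet_deleteEdges] at h2
  have h3 := Set.ncard_sdiff_add_ncard_of_subset hM.1 (Set.toFinite _)
  omega

/-- Matching-decyclability passes to graphs with an injective homomorphism into `G`. -/
lemma MDecyclable.of_injective {V W : Type*} {G : SimpleGraph V} {H : SimpleGraph W}
    (h : MDecyclable G) (φ : H →g G) (hφ : Function.Injective φ) : MDecyclable H := by
  obtain ⟨M, hM, hA⟩ := h
  refine ⟨H.edgeSet ∩ Sym2.map φ ⁻¹' M, ⟨Set.inter_subset_left, ?_⟩, ?_⟩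
  · intro e he f hf hef v hve hvf
    exact hM.2 _ he.2 _ hf.2 (fun hh => hef (Sym2.map.injective hφ hh)) (φ v)
      (Sym2.mem_map.2 ⟨v, hve, rfl⟩) (Sym2.mem_map.2 ⟨v, hvf, rfl⟩)
  · refine hA.comap ⟨φ, fun {u v} huv => ?_⟩ hφ
    simp only [SimpleGraph.deleteEdges_adj, Set.mem_inter_iff, not_and] at huv ⊢
    exact ⟨φ.map_adj huv.1, huv.2 huv.1⟩

/-- A finite matching-decyclable graph is sparse. -/
lemma MDecyclable.sparse {V : Type*} [Finite V] {G : SimpleGraph V} (h : MDecyclable G) :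
    Sparse G := by
  intro H hH
  have : Nonempty H.verts := hH.to_subtype
  have h1 := (h.of_injective H.hom H.hom_injective).ncard_edgeSet_le
  refine le_trans (le_of_eq ?_) h1
  rw [Nat.card_coe_set_eq, ← H.image_coe_edgeSet_coe,
    Set.ncard_image_of_injective _ (Sym2.map.injective Subtype.val_injective)]

theorem stmt19 {V : Type*} (G : SimpleGraph V) (hdh : DistHereditary G)
    (h2 : TwoConnected G) :
    (MDecyclable G ↔
      Nonempty (G ≃g triangleGraph) ∨ Nonempty (G ≃g SimpleGraph.cycleGraph 4) ∨
      Nonempty (G ≃g diamondGraph) ∨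
      Nonempty (G ≃g completeBipartiteGraph (Fin 2) (Fin 3)) ∨
      Nonempty (G ≃g K33minus)) ∧
    (MDecyclable G ↔
      Sparse G ∧ IsEmpty (completeBipartiteGraph (Fin 2) (Fin 4) ↪g G)) := by
  have : Finite V := Nat.finite_of_card_ne_zero (by have := h2.2.1; omega)
  exact ⟨⟨fun h => hdh.classification h2 h.sparse h.isEmpty_embedding, .of_iso⟩,
    fun h => ⟨h.sparse, h.isEmpty_embedding⟩,
    fun h => .of_iso (hdh.classification h2 h.1 h.2)⟩
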